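/- Let A_S be an Artin group of large type. Then any strictly decreasing chain P₀ ⊋ P₁ ⊋ ⋯ ⊋ P_k of parabolic subgroups of A_S satisfies k ≤ |S|; in particular there is no infinite strictly decreasing chain of parabolic subgroups of A_S. -/

import Mathlib

/-- The alternating word `sts⋯` of length `k` in the free group on `S`. -/
def braidWord {S : Type*} (k : ℕ) (s t : S) : FreeGroup S :=
  ((List.range k).map fun i => FreeGroup.of (if i % 2 = 0 then s else t)).prod

/-- The braid relations of the Artin group with Coxeter-type matrix `M`
(`M s t = ⊤` means no relation). -/
def artinRels {S : Type*} (M : S → S → ℕ∞) : Set (FreeGroup S) :=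
  { r | ∃ s t : S, s ≠ t ∧ ∃ k : ℕ, M s t = (k : ℕ∞) ∧
      r = braidWord k s t * (braidWord k t s)⁻¹ }

/-- The Artin group associated to the matrix `M`. -/
abbrev ArtinGroup {S : Type*} (M : S → S → ℕ∞) : Type _ := PresentedGroup (artinRels M)

/-- The standard parabolic subgroup `A_X` generated by the images of elements of `X ⊆ S`. -/
def StandardParabolic {S : Type*} (M : S → S → ℕ∞) (X : Set S) : Subgroup (ArtinGroup M) :=
  Subgroup.closure ((fun s => (PresentedGroup.of s : ArtinGroup M)) '' X)

/-- The conjugate `g H g⁻¹` of a subgroup. -/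
def conjSubgroup {G : Type*} [Group G] (g : G) (H : Subgroup G) : Subgroup G :=
  H.map (MulAut.conj g).toMonoidHom

/-- A parabolic subgroup: a conjugate of a standard parabolic subgroup. -/
def IsParabolic {S : Type*} (M : S → S → ℕ∞) (P : Subgroup (ArtinGroup M)) : Prop :=
  ∃ (g : ArtinGroup M) (X : Set S), P = conjSubgroup g (StandardParabolic M X)

namespace CoxeterSystem

variable {B W : Type*} [Group W] {M : CoxeterMatrix B} (cs : CoxeterSystem M W)

/-- The reversed right inversion sequence of an alternating word, listed explicitly. -/
theorem reverse_rightInvSeq_alternatingWord (i j : B) (n : ℕ) :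
    (cs.rightInvSeq (alternatingWord i j n)).reverse =
      (List.range n).map fun k => cs.simple j * (cs.simple i * cs.simple j) ^ k := by
  induction n generalizing i j with
  | zero => simp [alternatingWord]
  | succ n ih =>
    rw [alternatingWord_succ, rightInvSeq_concat, List.concat_eq_append, List.reverse_append,
      ← List.map_reverse, ih, List.range_succ_eq_map]
    simp only [List.reverse_cons, List.reverse_nil, List.nil_append, List.map_map, List.cons_append,
      List.map_cons, pow_zero, mul_one, List.cons.injEq, true_and]
    refine List.map_congr_left fun k _ => ?_
    simp only [Function.comp, MulAut.conj_apply, inv_simple, Nat.succ_eq_add_one, mul_assoc]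
    rw [← mul_assoc (cs.simple i), ← mul_pow_mul, mul_assoc, ← pow_succ]

open Classical in
/-- A simple reflection acting on signed group elements. -/
noncomputable def signedStep (i : B) : Function.End (W × ZMod 2) := fun p =>
  (cs.simple i * p.1 * cs.simple i, p.2 + if p.1 = cs.simple i then 1 else 0)

open Classical in
theorem prod_map_signedStep (ω : List B) (t : W) (ε : ZMod 2) :
    (ω.map cs.signedStep).prod (t, ε) =
      (cs.wordProd ω * t * (cs.wordProd ω)⁻¹, ε + ((cs.rightInvSeq ω).count t : ℕ)) := by
  induction ω with
  | nil => simp; rfl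
  | cons i ω ih =>
    have h : ((i :: ω).map cs.signedStep).prod (t, ε) =
        cs.signedStep i ((ω.map cs.signedStep).prod (t, ε)) := by
      simp only [List.map_cons, List.prod_cons]; rfl
    rw [h, ih]
    have h' : cs.wordProd ω * t * (cs.wordProd ω)⁻¹ = cs.simple i ↔
        (cs.wordProd ω)⁻¹ * cs.simple i * cs.wordProd ω = t := by
      rw [mul_inv_eq_iff_eq_mul, mul_assoc, inv_mul_eq_iff_eq_mul, eq_comm]
    simp only [signedStep, rightInvSeq, List.count_cons, wordProd_cons, mul_inv_rev, inv_simple,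
      h', beq_iff_eq, Nat.cast_add, Nat.cast_ite, Nat.cast_one, Nat.cast_zero, ← add_assoc]
    simp only [mul_assoc]

theorem isLiftable_signedStep : M.IsLiftable cs.signedStep := by
  classical
  intro i j
  have key : ∀ m, (cs.signedStep i * cs.signedStep j) ^ m =
      ((alternatingWord i j (2 * m)).map cs.signedStep).prod := by
    intro m
    induction m with
    | zero => simp [alternatingWord]
    | succ m ih =>
      rw [pow_succ', ih, show 2 * (m + 1) = 2 * m + 1 + 1 by ring, alternatingWord_succ',
        alternatingWord_succ']
      simp [mul_assoc, parity_simps]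
  rw [key]
  funext ⟨t, ε⟩
  rw [prod_map_signedStep]
  have h1 : cs.wordProd (alternatingWord i j (2 * M i j)) = 1 := by
    simp [prod_alternatingWord_eq_mul_pow]
  have h2 : (cs.rightInvSeq (alternatingWord i j (2 * M i j))).count t =
      2 * ((List.range (M i j)).map
        fun k => cs.simple j * (cs.simple i * cs.simple j) ^ k).count t := by
    rw [← List.count_reverse, reverse_rightInvSeq_alternatingWord, two_mul, List.range_add,
      List.map_append, List.count_append, two_mul, List.map_map]
    congr 3
    funext k
    simp [pow_add]
  rw [h1, h2]
  have : (2 : ZMod 2) = 0 := rfl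
  simp only [one_mul, inv_one, mul_one, Nat.cast_mul, Nat.cast_ofNat, this, zero_mul, add_zero]
  rfl

/-- The action of a Coxeter group on its signed elements. -/
noncomputable def signedHom : W →* Function.End (W × ZMod 2) :=
  cs.lift ⟨cs.signedStep, cs.isLiftable_signedStep⟩

/-- `cs.sign w t` is the parity of the number of occurrences of `t` in the right inversion sequence
of any word for `w`; for a reflection `t`, it is `1` exactly when `w` makes `t` negative. -/
noncomputable def sign (w t : W) : ZMod 2 := (cs.signedHom w (t, 0)).2

theorem signedHom_wordProd (ω : List B) :
    cs.signedHom (cs.wordProd ω) = (ω.map cs.signedStep).prod := by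
  simp only [wordProd, map_list_prod, List.map_map]
  congr 2
  funext i
  simp [signedHom]

open Classical in
theorem sign_wordProd (ω : List B) (t : W) :
    cs.sign (cs.wordProd ω) t = ((cs.rightInvSeq ω).count t : ℕ) := by
  rw [sign, signedHom_wordProd, prod_map_signedStep, zero_add]

theorem signedHom_apply (w t : W) (ε : ZMod 2) :
    cs.signedHom w (t, ε) = (w * t * w⁻¹, ε + cs.sign w t) := by
  classical
  obtain ⟨ω, rfl⟩ := cs.wordProd_surjective w
  rw [sign_wordProd, signedHom_wordProd, prod_map_signedStep]

theorem sign_mul (w w' t : W) :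
    cs.sign (w * w') t = cs.sign w' t + cs.sign w (w' * t * w'⁻¹) := by
  have h : cs.signedHom (w * w') (t, 0) = cs.signedHom w (cs.signedHom w' (t, 0)) := by
    rw [map_mul]; rfl
  rw [signedHom_apply, signedHom_apply, signedHom_apply] at h
  simpa using congrArg Prod.snd h

@[simp]
theorem sign_one (t : W) : cs.sign 1 t = 0 := by
  classical
  simpa using cs.sign_wordProd [] t

open Classical in
theorem sign_simple (i : B) (t : W) :
    cs.sign (cs.simple i) t = if t = cs.simple i then 1 else 0 := by
  have := cs.sign_wordProd [i] t
  simp only [wordProd_singleton, rightInvSeq_singleton, List.count_singleton] at this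
  rw [this]
  simp only [beq_iff_eq, Nat.cast_ite, Nat.cast_one, Nat.cast_zero, eq_comm (a := t)]

theorem sign_simple_self (i : B) : cs.sign (cs.simple i) (cs.simple i) = 1 := by
  simp [sign_simple]

theorem simple_ne_one (i : B) : cs.simple i ≠ 1 := by
  intro h
  simpa [h] using cs.sign_simple_self i

theorem sign_inv (w t : W) : cs.sign w⁻¹ (w * t * w⁻¹) = cs.sign w t := by
  have := cs.sign_mul w⁻¹ w t
  rw [inv_mul_cancel, sign_one] at this
  exact (CharTwo.add_eq_zero.1 this.symm).symm

theorem length_mul_lt_of_sign_ne_zero {w t : W} (h : cs.sign w t ≠ 0) :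
    cs.length (w * t) < cs.length w := by
  classical
  obtain ⟨ω, hω, rfl⟩ := cs.exists_isReduced w
  rw [sign_wordProd] at h
  have : t ∈ cs.rightInvSeq ω := by
    by_contra h'
    exact h (by simp [List.count_eq_zero_of_not_mem h'])
  exact (cs.isRightInversion_of_mem_rightInvSeq hω this).2

/-- An element of the subgroup generated by two simple reflections is the product of a word in
these. -/
theorem exists_word_of_mem_closure_pair {i j : B} {d : W}
    (hd : d ∈ Subgroup.closure {cs.simple i, cs.simple j}) :
    ∃ ω : List B, (∀ x ∈ ω, x = i ∨ x = j) ∧ cs.wordProd ω = d := by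
  induction hd using Subgroup.closure_induction with
  | mem x hx =>
    rcases hx with rfl | rfl
    · exact ⟨[i], by simp, by simp⟩
    · exact ⟨[j], by simp, by simp⟩
  | one => exact ⟨[], by simp, by simp⟩
  | mul x y _ _ hx hy =>
    obtain ⟨ω, h, rfl⟩ := hx
    obtain ⟨ω', h', rfl⟩ := hy
    refine ⟨ω ++ ω', fun x hx => ?_, cs.wordProd_append _ _⟩
    rcases List.mem_append.1 hx with hx | hx
    exacts [h x hx, h' x hx]
  | inv x _ hx =>
    obtain ⟨ω, h, rfl⟩ := hx
    exact ⟨ω.reverse, by simpa using h, cs.wordProd_reverse _⟩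

theorem wordProd_eq_one_of_sign_eq_zero {i j : B} (n : ℕ) (ω : List B) (hn : ω.length = n)
    (hω : ∀ x ∈ ω, x = i ∨ x = j) (hi : cs.sign (cs.wordProd ω) (cs.simple i) = 0)
    (hj : cs.sign (cs.wordProd ω) (cs.simple j) = 0) : cs.wordProd ω = 1 := by
  classical
  induction n using Nat.strong_induction_on generalizing ω with
  | _ n ih =>
  rcases List.eq_nil_or_concat ω with rfl | ⟨ω', x, rfl⟩
  · simp
  have hx : cs.sign (cs.wordProd (ω'.concat x)) (cs.simple x) = 0 := by
    rcases hω x (by simp) with rfl | rfl <;> assumption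
  rw [wordProd_concat] at hx hi hj ⊢
  rw [sign_mul, sign_simple_self, mul_inv_cancel_right, sign_wordProd] at hx
  have hmem : cs.simple x ∈ cs.rightInvSeq ω' := by
    by_contra h'
    simp [List.count_eq_zero_of_not_mem h'] at hx
  obtain ⟨k, hk, hkx⟩ := List.getElem_of_mem hmem
  have hdel := cs.wordProd_mul_getD_rightInvSeq ω' k
  rw [List.getD_eq_getElem _ _ hk, hkx] at hdel
  rw [hdel] at hi hj ⊢
  rw [length_rightInvSeq] at hk
  refine ih (ω'.eraseIdx k).length ?_ _ rfl (fun y hy => hω y ?_) hi hj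
  · rw [List.length_eraseIdx_of_lt hk, ← hn]
    simp
  · rw [List.concat_eq_append]
    exact List.mem_append_left _ (List.mem_of_mem_eraseIdx hy)

/-- A nontrivial element of a dihedral parabolic subgroup has a descent in that subgroup. -/
theorem eq_one_of_sign_eq_zero {i j : B} {d : W}
    (hd : d ∈ Subgroup.closure {cs.simple i, cs.simple j})
    (hi : cs.sign d (cs.simple i) = 0) (hj : cs.sign d (cs.simple j) = 0) : d = 1 := by
  obtain ⟨ω, hω, rfl⟩ := cs.exists_word_of_mem_closure_pair hd
  exact cs.wordProd_eq_one_of_sign_eq_zero _ ω rfl hω hi hj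

theorem conj_simple_eq_of_sign_eq_zero {i j a : B} {v : W}
    (hv : ∀ x ∈ Subgroup.closure {cs.simple i, cs.simple j}, cs.sign v⁻¹ x = 0)
    (ha : v * cs.simple a * v⁻¹ ∈ Subgroup.closure {cs.simple i, cs.simple j}) :
    v * cs.simple a * v⁻¹ = cs.simple i ∨ v * cs.simple a * v⁻¹ = cs.simple j := by
  classical
  set r := v * cs.simple a * v⁻¹ with hr
  have hsign : ∀ x ∈ Subgroup.closure {cs.simple i, cs.simple j}, x ≠ r → cs.sign r x = 0 := by
    intro x hx hxr
    have h1 : v⁻¹ * r = cs.simple a * v⁻¹ := by rw [hr]; group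
    have h2 := congrArg (fun w => cs.sign w x) h1
    simp only [sign_mul] at h2
    rw [hv x hx, hv _ (mul_mem (mul_mem ha hx) (inv_mem ha)), sign_simple, if_neg] at h2
    · simpa using h2
    · intro h3
      apply hxr
      rw [hr, ← h3]
      group
  by_contra! hne
  have h1 : r = 1 := cs.eq_one_of_sign_eq_zero ha
    (hsign _ (Subgroup.subset_closure (by simp)) hne.1.symm)
    (hsign _ (Subgroup.subset_closure (by simp)) hne.2.symm)
  rw [hr, conj_eq_one_iff] at h1
  exact cs.simple_ne_one a h1

/-- If `v` keeps two simple reflections positive and conjugates them into a dihedral parabolic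
subgroup, then it carries them to the standard generators of that subgroup. -/
theorem conj_simple_pair (hinj : Function.Injective cs.simple) {i j a b : B} (hab : a ≠ b) {v : W}
    (hva : cs.sign v (cs.simple a) = 0) (hvb : cs.sign v (cs.simple b) = 0)
    (ha : v * cs.simple a * v⁻¹ ∈ Subgroup.closure {cs.simple i, cs.simple j})
    (hb : v * cs.simple b * v⁻¹ ∈ Subgroup.closure {cs.simple i, cs.simple j}) :
    (v * cs.simple a * v⁻¹ = cs.simple i ∧ v * cs.simple b * v⁻¹ = cs.simple j) ∨
      (v * cs.simple a * v⁻¹ = cs.simple j ∧ v * cs.simple b * v⁻¹ = cs.simple i) := by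
  set D : Subgroup W := Subgroup.closure {cs.simple i, cs.simple j} with hD
  obtain ⟨d, hd, hmin⟩ : ∃ d ∈ D, ∀ d' ∈ D, cs.length (d * v) ≤ cs.length (d' * v) := by
    obtain ⟨d, hd, h⟩ := WellFounded.has_min (InvImage.wf (fun d => cs.length (d * v))
      Nat.lt_wfRel.wf) (D : Set W) ⟨1, one_mem D⟩
    exact ⟨d, hd, fun d' hd' => not_lt.1 (h d' hd')⟩
  set v' := d * v with hv'
  have hpos : ∀ x ∈ D, cs.sign v'⁻¹ x = 0 := by
    intro x hx
    by_contra h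
    have := cs.length_mul_lt_of_sign_ne_zero h
    rw [← cs.length_inv, mul_inv_rev, inv_inv, cs.length_inv, hv', ← mul_assoc] at this
    exact absurd (hmin _ (mul_mem (inv_mem hx) hd)) (not_le.2 this)
  have hconj : ∀ c, v' * cs.simple c * v'⁻¹ = d * (v * cs.simple c * v⁻¹) * d⁻¹ := by
    intro c; rw [hv']; group
  have hmem : ∀ c, v * cs.simple c * v⁻¹ ∈ D → v' * cs.simple c * v'⁻¹ ∈ D := by
    intro c hc
    rw [hconj]
    exact mul_mem (mul_mem hd hc) (inv_mem hd)
  have hra := cs.conj_simple_eq_of_sign_eq_zero hpos (hmem a ha)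
  have hrb := cs.conj_simple_eq_of_sign_eq_zero hpos (hmem b hb)
  have hsign : ∀ c, cs.sign v (cs.simple c) = 0 → v * cs.simple c * v⁻¹ ∈ D →
      cs.sign d⁻¹ (v' * cs.simple c * v'⁻¹) = 0 := by
    intro c hc hcD
    have h1 : v = d⁻¹ * v' := by rw [hv']; group
    rw [h1, sign_mul] at hc
    rwa [← cs.sign_inv v', hpos _ (hmem c hcD), zero_add] at hc
  have hsa := hsign a hva ha
  have hsb := hsign b hvb hb
  have hne : v' * cs.simple a * v'⁻¹ ≠ v' * cs.simple b * v'⁻¹ := fun h =>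
    hab (hinj (mul_left_cancel (mul_right_cancel h)))
  have hd1 : d⁻¹ = 1 := by
    apply cs.eq_one_of_sign_eq_zero (i := i) (j := j) (inv_mem hd)
    · rcases hra with h | h
      · rwa [h] at hsa
      · rcases hrb with h' | h'
        · rwa [h'] at hsb
        · exact absurd (h.trans h'.symm) hne
    · rcases hra with h | h
      · rcases hrb with h' | h'
        · exact absurd (h.trans h'.symm) hne
        · rwa [h'] at hsb
      · rwa [h] at hsa
  rw [inv_eq_one] at hd1
  rw [hv', hd1, one_mul] at hra hrb hne
  rcases hra with h | h <;> rcases hrb with h' | h'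
  · exact absurd (h.trans h'.symm) hne
  · exact Or.inl ⟨h, h'⟩
  · exact Or.inr ⟨h, h'⟩
  · exact absurd (h.trans h'.symm) hne

end CoxeterSystem

namespace CoxeterMatrix

variable {B : Type*} (M : CoxeterMatrix B)

/-- Twice the cosine matrix of `M`; an entry `0` of `M` stands for `∞`. -/
noncomputable def twoCosine (i j : B) : ℝ := -(2 * Real.cos (Real.pi / M i j))

/-- Twice the symmetric form of the geometric representation, as a functional for each vertex. -/
noncomputable def rootDual (i : B) : Module.Dual ℝ (B →₀ ℝ) :=
  Finsupp.lift ℝ ℝ B fun j => if M i j = 0 then -2 else M.twoCosine i j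

theorem rootDual_single (i j : B) :
    M.rootDual i (Finsupp.single j 1) = if M i j = 0 then -2 else M.twoCosine i j := by
  simp [rootDual]

theorem rootDual_single_self (i : B) : M.rootDual i (Finsupp.single i 1) = 2 := by
  simp [rootDual_single, twoCosine]

/-- A simple reflection in the geometric representation. -/
noncomputable def geomReflection (i : B) : (B →₀ ℝ) ≃ₗ[ℝ] (B →₀ ℝ) :=
  Module.reflection (M.rootDual_single_self i)

theorem rootDual_mul_rootDual_sub_two {i j : B} (h : M i j ≠ 0) :
    M.rootDual i (Finsupp.single j 1) * M.rootDual j (Finsupp.single i 1) - 2 =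
      2 * Real.cos (2 * Real.pi / M i j) := by
  rw [rootDual_single, rootDual_single, M.symmetric j i, if_neg h, if_neg h, twoCosine, twoCosine,
    M.symmetric j i, mul_div_assoc, Real.cos_two_mul]
  ring

theorem eval_S_mul_sin {i j : B} (h : M i j ≠ 0) (n : ℤ) :
    (Polynomial.Chebyshev.S ℝ n).eval
      (M.rootDual i (Finsupp.single j 1) * M.rootDual j (Finsupp.single i 1) - 2) *
      Real.sin (2 * Real.pi / M i j) = Real.sin ((n + 1) * (2 * Real.pi / M i j)) := by
  rw [rootDual_mul_rootDual_sub_two M h]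
  exact Polynomial.Chebyshev.S_two_mul_real_cos _ _

theorem sin_two_pi_div_pos {m : ℕ} (hm : 3 ≤ m) : 0 < Real.sin (2 * Real.pi / m) := by
  have : (3 : ℝ) ≤ m := by exact_mod_cast hm
  have := Real.pi_pos
  apply Real.sin_pos_of_pos_of_lt_pi
  · positivity
  · rw [div_lt_iff₀ (by linarith)]
    nlinarith

theorem isLiftable_geomReflection (hM : ∀ i j, i ≠ j → M i j ≠ 2) :
    M.IsLiftable M.geomReflection := by
  intro i j
  by_cases hij : i = j
  · subst hij
    rw [M.diagonal, pow_one]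
    ext1 v
    exact Module.involutive_reflection (M.rootDual_single_self i) v
  rcases Nat.eq_zero_or_pos (M i j) with h0 | hpos
  · rw [h0, pow_zero]
  have h3 : 3 ≤ M i j := by
    have := M.off_diagonal i j hij
    have := hM i j hij
    omega
  have hS := M.eval_S_mul_sin (i := i) (j := j) hpos.ne'
  have hsin := (sin_two_pi_div_pos h3).ne'
  have hm : (M i j : ℝ) ≠ 0 := by exact_mod_cast hpos.ne'
  have hzero : ∀ n : ℤ, Real.sin ((n + 1) * (2 * Real.pi / M i j)) = 0 →
      (Polynomial.Chebyshev.S ℝ n).eval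
        (M.rootDual i (Finsupp.single j 1) * M.rootDual j (Finsupp.single i 1) - 2) = 0 := by
    intro n hn
    have := hS n
    rw [hn] at this
    exact (mul_eq_zero.1 this).resolve_right hsin
  ext1 v
  rw [geomReflection, geomReflection, Module.reflection_mul_reflection_pow_apply]
  rcases Nat.even_or_odd' (M i j) with ⟨k, hk | hk⟩
  · have h1 : ((M i j : ℤ) - 1) / 2 = k - 1 := by omega
    have h2 : ((M i j : ℤ) - 2) / 2 = k - 1 := by omega
    have h3 : (Polynomial.Chebyshev.S ℝ (k - 1 : ℤ)).eval
        (M.rootDual i (Finsupp.single j 1) * M.rootDual j (Finsupp.single i 1) - 2) = 0 := by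
      apply hzero
      rw [← Real.sin_pi]
      congr 1
      have : (M i j : ℝ) = 2 * k := by exact_mod_cast hk
      field_simp
      push_cast
      rw [this]
      ring
    rw [h1, h2, h3]
    simp
  · have h1 : ((M i j : ℤ) - 1) / 2 = k := by omega
    have h2 : ((M i j : ℤ) - 2) / 2 = k - 1 := by omega
    have h3 : ((M i j : ℤ) - 3) / 2 = k - 1 := by omega
    have h4 : (M i j : ℤ) / 2 = k := by omega
    have h5 : (Polynomial.Chebyshev.S ℝ k).eval
        (M.rootDual i (Finsupp.single j 1) * M.rootDual j (Finsupp.single i 1) - 2) +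
        (Polynomial.Chebyshev.S ℝ (k - 1 : ℤ)).eval
        (M.rootDual i (Finsupp.single j 1) * M.rootDual j (Finsupp.single i 1) - 2) = 0 := by
      apply mul_right_cancel₀ hsin
      rw [add_mul, hS, hS, zero_mul]
      have : (M i j : ℝ) = 2 * k + 1 := by exact_mod_cast hk
      have h6 : (((k : ℤ) : ℝ) + 1) * (2 * Real.pi / M i j) =
          2 * Real.pi - (((k - 1 : ℤ) : ℝ) + 1) * (2 * Real.pi / M i j) := by
        field_simp
        push_cast
        rw [this]
        ring
      rw [h6, Real.sin_two_pi_sub]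
      ring
    rw [h1, h2, h3, h4, h5]
    simp

end CoxeterMatrix

namespace CoxeterSystem

variable {B W : Type*} [Group W] {M : CoxeterMatrix B} (cs : CoxeterSystem M W)

theorem dvd_of_simple_mul_simple_pow_eq_one (hM : ∀ i j, i ≠ j → M i j ≠ 2) {i j : B}
    (hij : i ≠ j) {n : ℕ} (h : (cs.simple i * cs.simple j) ^ n = 1) : M i j ∣ n := by
  have h1 := congrArg (cs.lift ⟨_, M.isLiftable_geomReflection hM⟩) h
  rw [map_pow, map_mul, map_one, lift_apply_simple, lift_apply_simple] at h1
  have h2 := congrArg (fun f : (B →₀ ℝ) ≃ₗ[ℝ] (B →₀ ℝ) => f (Finsupp.single i 1)) h1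
  simp only [CoxeterMatrix.geomReflection, Module.reflection_mul_reflection_pow_apply_self] at h2
  have hi := congrArg (fun v : B →₀ ℝ => v i) h2
  have hj := congrArg (fun v : B →₀ ℝ => v j) h2
  simp [hij, hij.symm] at hi hj
  rcases Nat.eq_zero_or_pos (M i j) with h0 | hpos
  · have h0' : M j i = 0 := by rw [M.symmetric, h0]
    simp only [M.rootDual_single, h0, h0'] at hj
    norm_num [Polynomial.Chebyshev.S_eval_two] at hj
    simp [h0, hj]
  have h3 : 3 ≤ M i j := by
    have := M.off_diagonal i j hij
    have := hM i j hij
    omega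
  have hS := M.eval_S_mul_sin (i := i) (j := j) hpos.ne'
  have hsin := CoxeterMatrix.sin_two_pi_div_pos h3
  have hm : (M i j : ℝ) ≠ 0 := by exact_mod_cast hpos.ne'
  have hne : M.rootDual j (Finsupp.single i 1) ≠ 0 := by
    have hcos : 0 < Real.cos (Real.pi / M i j) := by
      have : (3 : ℝ) ≤ M i j := by exact_mod_cast h3
      have := Real.pi_pos
      apply Real.cos_pos_of_mem_Ioo
      constructor
      · have : 0 < Real.pi / M i j := by positivity
        linarith
      · rw [div_lt_iff₀ (by linarith)]
        nlinarith
    rw [M.rootDual_single, M.symmetric j i, if_neg hpos.ne',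
      CoxeterMatrix.twoCosine, M.symmetric j i]
    linarith
  have hj' := hj.resolve_right hne
  rw [hj', add_zero] at hi
  have e1 := hS n
  have e2 := hS (n - 1)
  rw [hi, one_mul] at e1
  rw [hj', zero_mul] at e2
  push_cast at e1 e2
  rw [sub_add_cancel] at e2
  rw [add_mul, one_mul, Real.sin_add, ← e2, zero_mul, zero_add] at e1
  have hcos : Real.cos (n * (2 * Real.pi / M i j)) = 1 := by
    apply mul_right_cancel₀ hsin.ne'
    rw [one_mul, ← e1]
  obtain ⟨k, hk⟩ := (Real.cos_eq_one_iff _).1 hcos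
  have hk' : (n : ℝ) = k * M i j := by
    have := Real.pi_pos.ne'
    field_simp at hk
    linarith
  have hk'' : (n : ℤ) = k * M i j := by exact_mod_cast hk'
  exact Int.natCast_dvd_natCast.1 ⟨k, by rw [hk'', mul_comm]⟩

theorem orderOf_simple_mul_simple (hM : ∀ i j, i ≠ j → M i j ≠ 2) {i j : B} (hij : i ≠ j) :
    orderOf (cs.simple i * cs.simple j) = M i j :=
  Nat.dvd_antisymm (orderOf_dvd_of_pow_eq_one (cs.simple_mul_simple_pow i j))
    (cs.dvd_of_simple_mul_simple_pow_eq_one hM hij (pow_orderOf_eq_one _))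

theorem simple_injective (hM : ∀ i j, i ≠ j → M i j ≠ 2) : Function.Injective cs.simple := by
  intro i j h
  by_contra hij
  apply M.off_diagonal i j hij
  rw [← cs.orderOf_simple_mul_simple hM hij, h, simple_mul_simple_self, orderOf_one]

end CoxeterSystem

namespace CoxeterSystem

variable {B W : Type*} [Group W] {M : CoxeterMatrix B} (cs : CoxeterSystem M W)
  {A : Type*} [Group A] (σ : B → A) (Y : Set B)

theorem mem_rightInvSeq_alternatingWord {i j : B} {n : ℕ} {x : W} :
    x ∈ cs.rightInvSeq (alternatingWord i j n) ↔
      ∃ k < n, cs.simple j * (cs.simple i * cs.simple j) ^ k = x := by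
  rw [← List.mem_reverse, reverse_rightInvSeq_alternatingWord]
  simp

theorem mem_rightInvSeq_braidWord_swap {i j : B} {x : W}
    (h : x ∈ cs.rightInvSeq (alternatingWord i j (M i j))) :
    x ∈ cs.rightInvSeq (alternatingWord j i (M i j)) := by
  rw [mem_rightInvSeq_alternatingWord] at h ⊢
  obtain ⟨k, hk, rfl⟩ := h
  refine ⟨M i j - 1 - k, by omega, ?_⟩
  have h1 : (cs.simple j * cs.simple i) ^ (M i j - 1 - k + 1) =
      (cs.simple i * cs.simple j) ^ k := by
    rw [← mul_left_inj ((cs.simple j * cs.simple i) ^ k), ← pow_add,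
      show M i j - 1 - k + 1 + k = M i j by omega, simple_mul_simple_pow',
      ← inv_simple cs j, ← inv_simple cs i, ← mul_inv_rev, inv_pow, inv_simple, inv_simple,
      inv_mul_cancel]
  rw [← h1, pow_succ', mul_assoc, ← mul_assoc, ← mul_assoc]
  simp

theorem nodup_rightInvSeq_alternatingWord {i j : B} {n : ℕ}
    (h : n ≤ orderOf (cs.simple i * cs.simple j)) :
    (cs.rightInvSeq (alternatingWord i j n)).Nodup := by
  rw [← List.nodup_reverse, reverse_rightInvSeq_alternatingWord]
  refine List.Nodup.map_on (fun k hk l hl hkl => ?_) List.nodup_range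
  rw [List.mem_range] at hk hl
  exact pow_injOn_Iio_orderOf (hk.trans_le h) (hl.trans_le h) (mul_left_cancel hkl)

theorem wordProd_mem {D : Subgroup W} {ω : List B} (hω : ∀ x ∈ ω, cs.simple x ∈ D) :
    cs.wordProd ω ∈ D :=
  list_prod_mem fun x hx => by
    obtain ⟨i, hi, rfl⟩ := List.mem_map.1 hx
    exact hω i hi

theorem mem_of_mem_rightInvSeq {D : Subgroup W} {ω : List B} (hω : ∀ x ∈ ω, cs.simple x ∈ D)
    {r : W} (hr : r ∈ cs.rightInvSeq ω) : r ∈ D := by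
  induction ω with
  | nil => simp at hr
  | cons i ω ih =>
    rw [List.forall_mem_cons] at hω
    rcases List.mem_cons.1 hr with rfl | hr
    · exact mul_mem (mul_mem (inv_mem (cs.wordProd_mem hω.2)) hω.1) (cs.wordProd_mem hω.2)
    · exact ih hω.2 hr

theorem mem_alternatingWord {i j x : B} {n : ℕ} (h : x ∈ alternatingWord i j n) :
    x = i ∨ x = j := by
  induction n with
  | zero => simp [alternatingWord] at h
  | succ n ih =>
    rw [alternatingWord_succ'] at h
    rcases List.mem_cons.1 h with h | h
    · split_ifs at h
      exacts [Or.inr h, Or.inl h]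
    · exact ih h

/-- `cs.Absorbs Y v i` says that left multiplication by the `i`-th simple reflection preserves the
coset of `v` modulo the parabolic subgroup of `Y`, because `v` conjugates it into `Y`. -/
def Absorbs (v : W) (i : B) : Prop := ∃ a ∈ Y, v * cs.simple a * v⁻¹ = cs.simple i

variable {Y} in
theorem Absorbs.simple_mul_iff {v : W} {i : B} :
    cs.Absorbs Y (cs.simple i * v) i ↔ cs.Absorbs Y v i := by
  refine exists_congr fun a => and_congr_right fun _ => ?_
  rw [mul_inv_rev, inv_simple, ← mul_left_inj (cs.simple i), ← mul_right_inj (cs.simple i)]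
  simp [mul_assoc]

open Classical in
/-- The action of the `i`-th Artin generator on pairs consisting of an element of the Coxeter group
and an element of a group in which the generators in `Y` have a meaning. -/
noncomputable def parabolicStep (i : B) : Equiv.Perm (W × A) where
  toFun x := if h : cs.Absorbs Y x.1 i then (x.1, σ h.choose * x.2) else (cs.simple i * x.1, x.2)
  invFun x :=
    if h : cs.Absorbs Y x.1 i then (x.1, (σ h.choose)⁻¹ * x.2) else (cs.simple i * x.1, x.2)
  left_inv x := by
    by_cases h : cs.Absorbs Y x.1 i
    · simp [h]
    · simp [h, Absorbs.simple_mul_iff]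
  right_inv x := by
    by_cases h : cs.Absorbs Y x.1 i
    · simp [h]
    · simp [h, Absorbs.simple_mul_iff]

variable {Y}

theorem parabolicStep_of_conj_eq (hinj : Function.Injective cs.simple) {i a : B} (ha : a ∈ Y)
    {v : W} (h : v * cs.simple a * v⁻¹ = cs.simple i) (p : A) :
    cs.parabolicStep σ Y i (v, p) = (v, σ a * p) := by
  have h' : cs.Absorbs Y v i := ⟨a, ha, h⟩
  have : h'.choose = a :=
    hinj (mul_left_cancel (mul_right_cancel (h'.choose_spec.2.trans h.symm)))
  simp [parabolicStep, h', this]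

theorem parabolicStep_of_not {i : B} {v : W} (h : ¬ cs.Absorbs Y v i) (p : A) :
    cs.parabolicStep σ Y i (v, p) = (cs.simple i * v, p) := by
  simp [parabolicStep, h]

theorem prod_parabolicStep_of_forall_notMem {ω : List B} {v : W}
    (h : ∀ a ∈ Y, v * cs.simple a * v⁻¹ ∉ cs.rightInvSeq ω) (p : A) :
    (ω.map (cs.parabolicStep σ Y)).prod (v, p) = (cs.wordProd ω * v, p) := by
  induction ω with
  | nil => simp
  | cons i ω ih =>
    simp only [rightInvSeq, List.mem_cons, not_or] at h
    rw [List.map_cons, List.prod_cons, Equiv.Perm.mul_apply, ih fun a ha => (h a ha).2,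
      parabolicStep_of_not, wordProd_cons, mul_assoc]
    rintro ⟨a, ha, h'⟩
    apply (h a ha).1
    rw [← h']
    group

theorem prod_parabolicStep_of_mem (hinj : Function.Injective cs.simple) {D : Subgroup W} {a : B}
    (ha : a ∈ Y) {ω : List B} {v : W} (hω : ∀ x ∈ ω, cs.simple x ∈ D)
    (hnd : (cs.rightInvSeq ω).Nodup) (hmem : v * cs.simple a * v⁻¹ ∈ cs.rightInvSeq ω)
    (hD : ∀ b ∈ Y, v * cs.simple b * v⁻¹ ∈ D → b = a) (p : A) :
    (ω.map (cs.parabolicStep σ Y)).prod (v, p) = (cs.wordProd ω * v * cs.simple a, σ a * p) := by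
  induction ω with
  | nil => simp at hmem
  | cons i ω ih =>
    have hr := cs.mem_of_mem_rightInvSeq hω hmem
    rw [List.forall_mem_cons] at hω
    rw [rightInvSeq, List.nodup_cons] at hnd
    rw [List.map_cons, List.prod_cons, Equiv.Perm.mul_apply, wordProd_cons]
    rcases List.mem_cons.1 hmem with hmem | hmem
    · have hi : cs.wordProd ω * v * cs.simple a * (cs.wordProd ω * v)⁻¹ = cs.simple i := by
        rw [mul_inv_rev, show cs.wordProd ω * v * cs.simple a * (v⁻¹ * (cs.wordProd ω)⁻¹) =
          cs.wordProd ω * (v * cs.simple a * v⁻¹) * (cs.wordProd ω)⁻¹ by group, hmem]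
        group
      rw [prod_parabolicStep_of_forall_notMem, parabolicStep_of_conj_eq cs σ hinj ha hi, ← hi]
      · simp [mul_assoc]
      · intro b hb hb'
        obtain rfl := hD b hb (cs.mem_of_mem_rightInvSeq hω.2 hb')
        exact hnd.1 (hmem ▸ hb')
    · rw [ih hω.2 hnd.2 hmem, parabolicStep_of_not]
      · simp only [mul_assoc]
      rintro ⟨b, hb, h⟩
      have hb' : v * cs.simple b * v⁻¹ = (v * cs.simple a * v⁻¹)⁻¹ *
          ((cs.wordProd ω)⁻¹ * cs.simple i * cs.wordProd ω) * (v * cs.simple a * v⁻¹) := by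
        rw [← h]
        group
      obtain rfl := hD b hb (by
        rw [hb']
        have := cs.wordProd_mem hω.2
        exact mul_mem (mul_mem (inv_mem hr) (mul_mem (mul_mem (inv_mem this) hω.1) this)) hr)
      apply hnd.1
      convert hmem using 1
      rw [← h]
      group

theorem prod_parabolicStep_alternatingWord (hinj : Function.Injective cs.simple) {i j a b : B}
    (ha : a ∈ Y) (hb : b ∈ Y) {v : W} (hai : v * cs.simple a * v⁻¹ = cs.simple i)
    (hbj : v * cs.simple b * v⁻¹ = cs.simple j) (n : ℕ) (p : A) :
    ((alternatingWord i j n).map (cs.parabolicStep σ Y)).prod (v, p) =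
      (v, ((alternatingWord a b n).map σ).prod * p) := by
  induction n with
  | zero => simp [alternatingWord]
  | succ n ih =>
    rw [alternatingWord_succ', alternatingWord_succ']
    simp only [List.map_cons, List.prod_cons, Equiv.Perm.mul_apply, ih]
    split_ifs
    · rw [parabolicStep_of_conj_eq cs σ hinj hb hbj, mul_assoc]
    · rw [parabolicStep_of_conj_eq cs σ hinj ha hai, mul_assoc]

theorem prod_parabolicStep_braidWord (hM : ∀ i j, i ≠ j → M i j ≠ 2)
    (hσ : ∀ i j, i ≠ j → M i j ≠ 0 → ((alternatingWord i j (M i j)).map σ).prod =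
      ((alternatingWord j i (M i j)).map σ).prod) {i j : B} (hij : i ≠ j) (h0 : M i j ≠ 0)
    {v : W} (hv : ∀ a ∈ Y, cs.sign v (cs.simple a) = 0) (p : A) :
    ((alternatingWord i j (M i j)).map (cs.parabolicStep σ Y)).prod (v, p) =
      ((alternatingWord j i (M i j)).map (cs.parabolicStep σ Y)).prod (v, p) := by
  have hinj := cs.simple_injective hM
  set D := Subgroup.closure {cs.simple i, cs.simple j} with hDdef
  have hiD : cs.simple i ∈ D := Subgroup.subset_closure (by simp)
  have hjD : cs.simple j ∈ D := Subgroup.subset_closure (by simp)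
  have hw : ∀ x ∈ alternatingWord i j (M i j), cs.simple x ∈ D := by
    intro x hx
    rcases mem_alternatingWord hx with rfl | rfl <;> assumption
  have hw' : ∀ x ∈ alternatingWord j i (M i j), cs.simple x ∈ D := by
    intro x hx
    rcases mem_alternatingWord hx with rfl | rfl <;> assumption
  have hπ : cs.wordProd (alternatingWord i j (M i j)) =
      cs.wordProd (alternatingWord j i (M i j)) := by
    have := cs.wordProd_braidWord_eq i j
    rwa [braidWord, braidWord, M.symmetric j i] at this
  have hmem : ∀ x, x ∈ cs.rightInvSeq (alternatingWord i j (M i j)) ↔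
      x ∈ cs.rightInvSeq (alternatingWord j i (M i j)) := by
    refine fun x => ⟨cs.mem_rightInvSeq_braidWord_swap, fun h => ?_⟩
    rw [M.symmetric i j] at h ⊢
    exact cs.mem_rightInvSeq_braidWord_swap h
  by_cases h1 : ∃ a ∈ Y, v * cs.simple a * v⁻¹ ∈ cs.rightInvSeq (alternatingWord i j (M i j))
  · obtain ⟨a, ha, har⟩ := h1
    have haD := cs.mem_of_mem_rightInvSeq hw har
    by_cases h2 : ∀ b ∈ Y, v * cs.simple b * v⁻¹ ∈ D → b = a
    · rw [cs.prod_parabolicStep_of_mem σ hinj ha hw _ har h2,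
        cs.prod_parabolicStep_of_mem σ hinj ha hw' _ ((hmem _).1 har) h2, hπ]
      · apply cs.nodup_rightInvSeq_alternatingWord
        rw [cs.orderOf_simple_mul_simple hM hij.symm, M.symmetric i j]
      · apply cs.nodup_rightInvSeq_alternatingWord
        rw [cs.orderOf_simple_mul_simple hM hij]
    · push Not at h2
      obtain ⟨b, hb, hbD, hba⟩ := h2
      have key : ∀ c ∈ Y, ∀ d ∈ Y, v * cs.simple c * v⁻¹ = cs.simple i →
          v * cs.simple d * v⁻¹ = cs.simple j →
          ((alternatingWord i j (M i j)).map (cs.parabolicStep σ Y)).prod (v, p) =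
          ((alternatingWord j i (M i j)).map (cs.parabolicStep σ Y)).prod (v, p) := by
        intro c hc d hd hci hdj
        have hcd : c ≠ d := by
          rintro rfl
          exact hij (hinj (hci.symm.trans hdj))
        have hMcd : M c d = M i j := by
          rw [← cs.orderOf_simple_mul_simple hM hcd, ← cs.orderOf_simple_mul_simple hM hij, ← hci,
            ← hdj, ← MulAut.conj_apply, ← MulAut.conj_apply, ← map_mul]
          exact (orderOf_injective (MulAut.conj v).toMonoidHom (MulAut.conj v).injective _).symm
        rw [cs.prod_parabolicStep_alternatingWord σ hinj hc hd hci hdj,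
          cs.prod_parabolicStep_alternatingWord σ hinj hd hc hdj hci, ← hMcd,
          hσ c d hcd (hMcd ▸ h0)]
      rcases cs.conj_simple_pair hinj hba.symm (hv a ha) (hv b hb) haD hbD with h | h
      · exact key a ha b hb h.1 h.2
      · exact key b hb a ha h.2 h.1
  · push Not at h1
    rw [cs.prod_parabolicStep_of_forall_notMem σ h1, cs.prod_parabolicStep_of_forall_notMem σ, hπ]
    exact fun a ha h => h1 a ha ((hmem _).2 h)

theorem sign_parabolicStep (i : B) (x : W × A) {a : B} (ha : a ∈ Y) :
    cs.sign (cs.parabolicStep σ Y i x).1 (cs.simple a) = cs.sign x.1 (cs.simple a) := by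
  classical
  obtain ⟨v, p⟩ := x
  by_cases h : cs.Absorbs Y v i
  · simp [parabolicStep, h]
  · rw [parabolicStep_of_not cs σ h, sign_mul, sign_simple, if_neg, add_zero]
    exact fun h' => h ⟨a, ha, h'⟩

variable (Y)

/-- The restriction of `parabolicStep` to pairs whose first component keeps `Y` positive. -/
noncomputable def positiveStep (i : B) :
    Equiv.Perm {x : W × A // ∀ a ∈ Y, cs.sign x.1 (cs.simple a) = 0} :=
  (cs.parabolicStep σ Y i).subtypePerm fun x =>
    forall₂_congr fun a ha => by rw [cs.sign_parabolicStep σ i x ha]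

variable {Y}

theorem coe_prod_positiveStep (ω : List B)
    (x : {x : W × A // ∀ a ∈ Y, cs.sign x.1 (cs.simple a) = 0}) :
    ((ω.map (cs.positiveStep σ Y)).prod x : W × A) = (ω.map (cs.parabolicStep σ Y)).prod x := by
  induction ω with
  | nil => rfl
  | cons i ω ih =>
    simp only [List.map_cons, List.prod_cons, Equiv.Perm.mul_apply, ← ih]
    rfl

theorem prod_positiveStep_braidWord (hM : ∀ i j, i ≠ j → M i j ≠ 2)
    (hσ : ∀ i j, i ≠ j → M i j ≠ 0 → ((alternatingWord i j (M i j)).map σ).prod =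
      ((alternatingWord j i (M i j)).map σ).prod) {i j : B} (hij : i ≠ j) (h0 : M i j ≠ 0) :
    ((alternatingWord i j (M i j)).map (cs.positiveStep σ Y)).prod =
      ((alternatingWord j i (M i j)).map (cs.positiveStep σ Y)).prod := by
  ext1 ⟨⟨v, p⟩, hv⟩
  apply Subtype.ext
  rw [coe_prod_positiveStep, coe_prod_positiveStep]
  exact cs.prod_parabolicStep_braidWord σ hM hσ hij h0 hv p

end CoxeterSystem

theorem braidWord_eq_prod_alternatingWord {S : Type*} (k : ℕ) (s t : S) :
    braidWord k s t =
      ((if Even k then CoxeterSystem.alternatingWord s t k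
        else CoxeterSystem.alternatingWord t s k).map FreeGroup.of).prod := by
  induction k with
  | zero => simp [braidWord, CoxeterSystem.alternatingWord]
  | succ k ih =>
    have h : braidWord (k + 1) s t =
        braidWord k s t * FreeGroup.of (if k % 2 = 0 then s else t) := by
      simp [braidWord, List.range_succ]
    rw [h, ih]
    rcases Nat.even_or_odd k with hk | hk
    · have hk' : ¬ Even (k + 1) := by simpa [parity_simps] using hk
      rw [if_pos hk, if_neg hk', if_pos (Nat.even_iff.1 hk), CoxeterSystem.alternatingWord_succ]
      simp
    · have hk' : Even (k + 1) := hk.add_one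
      rw [if_neg (Nat.not_even_iff_odd.2 hk), if_pos hk', if_neg (by simp [Nat.odd_iff.1 hk]),
        CoxeterSystem.alternatingWord_succ]
      simp

namespace ArtinGroup

variable {S : Type*} (M : S → S → ℕ∞)

theorem map_alternatingWord_eq_iff {G : Type*} [Group G] (f : S → G) (k : ℕ) (s t : S) :
    ((CoxeterSystem.alternatingWord s t k).map f).prod =
        ((CoxeterSystem.alternatingWord t s k).map f).prod ↔
      FreeGroup.lift f (braidWord k s t * (braidWord k t s)⁻¹) = 1 := by
  have h : ∀ ω : List S, FreeGroup.lift f (ω.map FreeGroup.of).prod = (ω.map f).prod := by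
    intro ω
    rw [map_list_prod, List.map_map]
    congr 2
    funext i
    simp
  rw [map_mul, map_inv, mul_inv_eq_one, braidWord_eq_prod_alternatingWord,
    braidWord_eq_prod_alternatingWord, h, h]
  split_ifs
  · rfl
  · exact eq_comm

theorem map_of_alternatingWord {k : ℕ} {s t : S} (hst : s ≠ t) (hk : M s t = k) :
    ((CoxeterSystem.alternatingWord s t k).map
        fun i => (PresentedGroup.of i : ArtinGroup M)).prod =
      ((CoxeterSystem.alternatingWord t s k).map
        fun i => (PresentedGroup.of i : ArtinGroup M)).prod := by
  rw [map_alternatingWord_eq_iff]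
  have h : FreeGroup.lift (fun i => (PresentedGroup.of i : ArtinGroup M)) =
      PresentedGroup.mk (artinRels M) := by
    ext i
    simp [PresentedGroup.of]
  rw [h]
  exact PresentedGroup.one_of_mem ⟨s, t, hst, k, hk, rfl⟩

open Classical in
/-- The Coxeter matrix of a large-type Artin group, with `0` in place of `⊤`. -/
noncomputable def coxeterMatrix (hsymm : ∀ s t, M s t = M t s)
    (hlarge : ∀ s t, s ≠ t → 3 ≤ M s t) : CoxeterMatrix S where
  M := Matrix.of fun s t => if s = t then 1 else (M s t).toNat
  isSymm := by
    ext s t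
    simp [eq_comm, hsymm s t]
  diagonal := by simp
  off_diagonal s t hst h := by
    have h3 := hlarge s t hst
    simp only [Matrix.of_apply, hst, if_false] at h
    cases hm : M s t with
    | top => simp [hm] at h
    | coe k =>
      rw [hm] at h h3
      have : 3 ≤ k := by exact_mod_cast h3
      simp at h
      omega

variable {M} {hsymm : ∀ s t, M s t = M t s} {hlarge : ∀ s t, s ≠ t → 3 ≤ M s t}

theorem coxeterMatrix_apply {s t : S} (hst : s ≠ t) :
    coxeterMatrix M hsymm hlarge s t = (M s t).toNat := by
  simp [coxeterMatrix, hst]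

theorem coxeterMatrix_ne_two (s t : S) (hst : s ≠ t) : coxeterMatrix M hsymm hlarge s t ≠ 2 := by
  have h3 := hlarge s t hst
  rw [coxeterMatrix_apply hst]
  cases hm : M s t with
  | top => simp
  | coe k =>
    rw [hm] at h3
    have : 3 ≤ k := by exact_mod_cast h3
    simp
    omega

variable (M hsymm hlarge) in
/-- The Coxeter system of a large-type Artin group. -/
noncomputable abbrev coxeterSystem :
    CoxeterSystem (coxeterMatrix M hsymm hlarge) (coxeterMatrix M hsymm hlarge).Group :=
  (coxeterMatrix M hsymm hlarge).toCoxeterSystem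

variable (M hsymm hlarge) in
/-- Pairs of a Coxeter group element keeping `Y` positive and an Artin group element. -/
abbrev PositivePair (Y : Set S) : Type _ :=
  {x : (coxeterMatrix M hsymm hlarge).Group × ArtinGroup M //
    ∀ a ∈ Y, (coxeterSystem M hsymm hlarge).sign x.1
      ((coxeterSystem M hsymm hlarge).simple a) = 0}

variable (hsymm hlarge) in
/-- The action of a large-type Artin group induced from the left multiplication action of the
standard parabolic subgroup of `Y`. -/
noncomputable def parabolicAction (Y : Set S) :
    ArtinGroup M →* Equiv.Perm (PositivePair M hsymm hlarge Y) :=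
  PresentedGroup.toGroup
    (f := (coxeterSystem M hsymm hlarge).positiveStep (fun i => (PresentedGroup.of i)) Y) <| by
    rintro _ ⟨s, t, hst, k, hk, rfl⟩
    have hkk : ∀ {s t : S}, s ≠ t → coxeterMatrix M hsymm hlarge s t ≠ 0 →
        M s t = coxeterMatrix M hsymm hlarge s t := by
      intro s t hst h0
      rw [coxeterMatrix_apply hst] at h0 ⊢
      rw [ENat.natCast_toNat]
      rintro h
      simp [h] at h0
    have hk' : coxeterMatrix M hsymm hlarge s t = k := by
      rw [coxeterMatrix_apply hst, hk, ENat.toNat_natCast]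
    rw [← map_alternatingWord_eq_iff, ← hk']
    refine CoxeterSystem.prod_positiveStep_braidWord _ _ coxeterMatrix_ne_two
      (fun i j hij h0 => map_of_alternatingWord M hij (hkk hij h0)) hst ?_
    rintro h0
    obtain rfl := hk'.symm.trans h0
    have := hlarge s t hst
    rw [hk] at this
    exact absurd this (by norm_num)

variable {Y : Set S}

theorem parabolicAction_of (i : S) (x : PositivePair M hsymm hlarge Y) :
    (parabolicAction hsymm hlarge Y (PresentedGroup.of i) x).1 =
      (coxeterSystem M hsymm hlarge).parabolicStep (fun i => (PresentedGroup.of i)) Y i x.1 := by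
  rw [parabolicAction, PresentedGroup.toGroup.of]
  rfl

theorem commute_parabolicAction {f : Equiv.Perm (PositivePair M hsymm hlarge Y)}
    (h : ∀ i, Commute (parabolicAction hsymm hlarge Y (PresentedGroup.of i)) f)
    (g : ArtinGroup M) : Commute (parabolicAction hsymm hlarge Y g) f := by
  have hg : g ∈ Subgroup.closure (Set.range fun i => (PresentedGroup.of i : ArtinGroup M)) := by
    rw [PresentedGroup.closure_range_of]
    exact Subgroup.mem_top g
  induction hg using Subgroup.closure_induction with
  | mem _ hx =>
    obtain ⟨i, rfl⟩ := hx
    exact h i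
  | one => simp
  | mul x y _ _ hx hy => rw [map_mul]; exact hx.mul_left hy
  | inv x _ hx => rw [map_inv]; exact hx.inv_left

variable (hsymm hlarge Y) in
/-- Right multiplication on the Artin group component. -/
noncomputable def mulRightPerm (q : ArtinGroup M) : Equiv.Perm (PositivePair M hsymm hlarge Y) :=
  Equiv.Perm.subtypePerm ((Equiv.refl _).prodCongr (Equiv.mulRight q)) fun _ => Iff.rfl

theorem coe_mulRightPerm (q : ArtinGroup M) (x : PositivePair M hsymm hlarge Y) :
    (mulRightPerm hsymm hlarge Y q x).1 = (x.1.1, x.1.2 * q) := rfl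

theorem commute_mulRightPerm (g q : ArtinGroup M) :
    Commute (parabolicAction hsymm hlarge Y g) (mulRightPerm hsymm hlarge Y q) := by
  refine commute_parabolicAction (fun i => ?_) g
  ext1 ⟨⟨v, p⟩, hv⟩
  apply Subtype.ext
  rw [Equiv.Perm.mul_apply, Equiv.Perm.mul_apply, parabolicAction_of, coe_mulRightPerm,
    coe_mulRightPerm, parabolicAction_of]
  dsimp only
  by_cases h : (coxeterSystem M hsymm hlarge).Absorbs Y v i
  · obtain ⟨a, ha, h⟩ := h
    have hinj := (coxeterSystem M hsymm hlarge).simple_injective coxeterMatrix_ne_two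
    rw [CoxeterSystem.parabolicStep_of_conj_eq _ _ hinj ha h,
      CoxeterSystem.parabolicStep_of_conj_eq _ _ hinj ha h]
    simp [mul_assoc]
  · rw [CoxeterSystem.parabolicStep_of_not _ _ h, CoxeterSystem.parabolicStep_of_not _ _ h]

theorem parabolicAction_snd_mem_iff (g : ArtinGroup M) (x : PositivePair M hsymm hlarge Y) :
    (parabolicAction hsymm hlarge Y g x).1.2 ∈ StandardParabolic M Y ↔
      x.1.2 ∈ StandardParabolic M Y := by
  have hg : g ∈ Subgroup.closure (Set.range fun i => (PresentedGroup.of i : ArtinGroup M)) := by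
    rw [PresentedGroup.closure_range_of]
    exact Subgroup.mem_top g
  induction hg using Subgroup.closure_induction generalizing x with
  | mem _ hx =>
    obtain ⟨i, rfl⟩ := hx
    rw [parabolicAction_of]
    obtain ⟨⟨v, p⟩, hv⟩ := x
    by_cases h : (coxeterSystem M hsymm hlarge).Absorbs Y v i
    · obtain ⟨a, ha, h⟩ := h
      have hinj := (coxeterSystem M hsymm hlarge).simple_injective coxeterMatrix_ne_two
      rw [CoxeterSystem.parabolicStep_of_conj_eq _ _ hinj ha h]
      exact Subgroup.mul_mem_cancel_left _ (Subgroup.subset_closure ⟨a, ha, rfl⟩)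
    · rw [CoxeterSystem.parabolicStep_of_not _ _ h]
  | one => simp
  | mul g h _ _ ihg ihh =>
    rw [map_mul, Equiv.Perm.mul_apply]
    exact (ihg _).trans (ihh _)
  | inv g _ ihg =>
    refine (ihg _).symm.trans ?_
    rw [← Equiv.Perm.mul_apply, ← map_mul, mul_inv_cancel, map_one, Equiv.Perm.one_apply]

variable (hsymm hlarge Y) in
/-- The base point of the action. -/
noncomputable def basePair : PositivePair M hsymm hlarge Y := ⟨(1, 1), by simp⟩

theorem parabolicAction_basePair {a : ArtinGroup M} (ha : a ∈ StandardParabolic M Y) :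
    parabolicAction hsymm hlarge Y a (basePair hsymm hlarge Y) =
      mulRightPerm hsymm hlarge Y a (basePair hsymm hlarge Y) := by
  have hR : ∀ p q : ArtinGroup M, mulRightPerm hsymm hlarge Y p
      (mulRightPerm hsymm hlarge Y q (basePair hsymm hlarge Y)) =
        mulRightPerm hsymm hlarge Y (q * p) (basePair hsymm hlarge Y) := by
    intro p q
    apply Subtype.ext
    simp [coe_mulRightPerm, mul_assoc]
  have hC : ∀ (g q : ArtinGroup M) x,
      parabolicAction hsymm hlarge Y g (mulRightPerm hsymm hlarge Y q x) =
        mulRightPerm hsymm hlarge Y q (parabolicAction hsymm hlarge Y g x) := fun g q x => by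
    rw [← Equiv.Perm.mul_apply, (commute_mulRightPerm g q).eq, Equiv.Perm.mul_apply]
  induction ha using Subgroup.closure_induction with
  | mem _ hx =>
    obtain ⟨y, hy, rfl⟩ := hx
    apply Subtype.ext
    have hinj := (coxeterSystem M hsymm hlarge).simple_injective coxeterMatrix_ne_two
    rw [parabolicAction_of]
    rw [coe_mulRightPerm, basePair]
    dsimp only
    rw [CoxeterSystem.parabolicStep_of_conj_eq _ _ hinj hy (by simp)]
    simp
  | one =>
    apply Subtype.ext
    simp [coe_mulRightPerm]
  | mul a b _ _ ha hb => rw [map_mul, Equiv.Perm.mul_apply, hb, hC, ha, hR]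
  | inv a _ ha =>
    rw [map_inv, Equiv.Perm.inv_eq_iff_eq, hC, ha, hR, mul_inv_cancel]
    apply Subtype.ext
    simp [coe_mulRightPerm]

/-- A conjugate of a standard parabolic subgroup contained in another standard parabolic subgroup
has its standard generators simultaneously conjugate, inside the latter, to standard generators. -/
theorem exists_conj_eq_of_conjSubgroup_le (hsymm : ∀ s t, M s t = M t s)
    (hlarge : ∀ s t, s ≠ t → 3 ≤ M s t) {X : Set S} {g : ArtinGroup M}
    (h : conjSubgroup g (StandardParabolic M X) ≤ StandardParabolic M Y) :
    ∃ p ∈ StandardParabolic M Y, ∃ τ : S → S, Set.MapsTo τ X Y ∧ Set.InjOn τ X ∧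
      ∀ x ∈ X, PresentedGroup.of (τ x) * p = p * (g * PresentedGroup.of x * g⁻¹) := by
  have hinj := (coxeterSystem M hsymm hlarge).simple_injective coxeterMatrix_ne_two
  obtain ⟨⟨⟨w, p⟩, hw⟩, hz⟩ :
      ∃ z, z = parabolicAction hsymm hlarge Y g⁻¹ (basePair hsymm hlarge Y) := ⟨_, rfl⟩
  have hp : p ∈ StandardParabolic M Y := by
    have := parabolicAction_snd_mem_iff g⁻¹ (basePair hsymm hlarge Y)
    rw [← hz] at this
    exact this.2 (one_mem _)
  have key : ∀ x ∈ X, ∃ a ∈ Y, w * (coxeterSystem M hsymm hlarge).simple a * w⁻¹ =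
      (coxeterSystem M hsymm hlarge).simple x ∧
      PresentedGroup.of a * p = p * (g * PresentedGroup.of x * g⁻¹) := by
    intro x hx
    have hmem : g * PresentedGroup.of x * g⁻¹ ∈ StandardParabolic M Y :=
      h ⟨_, Subgroup.subset_closure ⟨x, hx, rfl⟩, rfl⟩
    have h1 : parabolicAction hsymm hlarge Y (PresentedGroup.of x) ⟨(w, p), hw⟩ =
        mulRightPerm hsymm hlarge Y (g * PresentedGroup.of x * g⁻¹) ⟨(w, p), hw⟩ := by
      rw [hz, ← Equiv.Perm.mul_apply, ← Equiv.Perm.mul_apply, ← map_mul,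
        ← (commute_mulRightPerm g⁻¹ _).eq, Equiv.Perm.mul_apply, ← parabolicAction_basePair hmem,
        ← Equiv.Perm.mul_apply, ← map_mul]
      congr 2
      group
    have h2 := congrArg Subtype.val h1
    rw [parabolicAction_of] at h2
    rw [coe_mulRightPerm] at h2
    dsimp only at h2
    by_cases hx' : (coxeterSystem M hsymm hlarge).Absorbs Y w x
    · obtain ⟨a, ha, hax⟩ := hx'
      rw [CoxeterSystem.parabolicStep_of_conj_eq _ _ hinj ha hax] at h2
      exact ⟨a, ha, hax, congrArg Prod.snd h2⟩
    · rw [CoxeterSystem.parabolicStep_of_not _ _ hx'] at h2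
      have h3 := congrArg Prod.fst h2
      exact absurd (mul_eq_right.1 h3) (CoxeterSystem.simple_ne_one _ x)
  choose! τ hτ using key
  refine ⟨p, hp, τ, fun x hx => (hτ x hx).1, fun x hx x' hx' hxx => hinj ?_,
    fun x hx => (hτ x hx).2.2⟩
  rw [← (hτ x hx).2.1, ← (hτ x' hx').2.1, hxx]

theorem conjSubgroup_conjSubgroup {G : Type*} [Group G] (g h : G) (H : Subgroup G) :
    conjSubgroup g (conjSubgroup h H) = conjSubgroup (g * h) H := by
  rw [conjSubgroup, conjSubgroup, conjSubgroup, Subgroup.map_map, map_mul]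
  rfl

theorem conjSubgroup_one {G : Type*} [Group G] (H : Subgroup G) : conjSubgroup 1 H = H := by
  ext x
  simp [conjSubgroup]

theorem le_conjSubgroup_of_ncard_le [Finite S] (hsymm : ∀ s t, M s t = M t s)
    (hlarge : ∀ s t, s ≠ t → 3 ≤ M s t) {X : Set S} {g : ArtinGroup M}
    (h : conjSubgroup g (StandardParabolic M X) ≤ StandardParabolic M Y)
    (hcard : Y.ncard ≤ X.ncard) :
    StandardParabolic M Y ≤ conjSubgroup g (StandardParabolic M X) := by
  obtain ⟨p, hp, τ, hmaps, hinj, hτ⟩ :=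
    exists_conj_eq_of_conjSubgroup_le hsymm hlarge h
  have himage : τ '' X = Y :=
    Set.eq_of_subset_of_ncard_le hmaps.image_subset (by rwa [hinj.ncard_image])
  have hle : StandardParabolic M Y ≤ conjSubgroup (p * g) (StandardParabolic M X) := by
    refine (Subgroup.closure_le _).2 ?_
    rintro _ ⟨y, hy, rfl⟩
    rw [← himage] at hy
    obtain ⟨x, hx, rfl⟩ := hy
    refine ⟨PresentedGroup.of x, Subgroup.subset_closure ⟨x, hx, rfl⟩, ?_⟩
    have := eq_mul_inv_of_mul_eq (hτ x hx)
    simp only [this, MulEquiv.coe_toMonoidHom, MulAut.conj_apply]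
    group
  intro a ha
  obtain ⟨b, hb, hba⟩ := hle (mul_mem (mul_mem hp ha) (inv_mem hp))
  refine ⟨b, hb, ?_⟩
  simp only [MulEquiv.coe_toMonoidHom, MulAut.conj_apply, mul_inv_rev] at hba ⊢
  rw [← mul_left_inj p⁻¹, ← mul_right_inj p, ← mul_assoc p a, ← hba]
  simp only [mul_assoc]

theorem ncard_lt_ncard_of_conjSubgroup_lt [Finite S] (hsymm : ∀ s t, M s t = M t s)
    (hlarge : ∀ s t, s ≠ t → 3 ≤ M s t) {X : Set S} {g h : ArtinGroup M}
    (hlt : conjSubgroup g (StandardParabolic M X) < conjSubgroup h (StandardParabolic M Y)) :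
    X.ncard < Y.ncard := by
  have hle : conjSubgroup (h⁻¹ * g) (StandardParabolic M X) ≤ StandardParabolic M Y := by
    have := Subgroup.map_mono (f := (MulAut.conj h⁻¹).toMonoidHom) hlt.le
    change conjSubgroup _ _ ≤ conjSubgroup _ (conjSubgroup _ _) at this
    rw [conjSubgroup_conjSubgroup, conjSubgroup_conjSubgroup, inv_mul_cancel,
      conjSubgroup_one] at this
    exact this
  by_contra! hcard
  apply hlt.not_ge
  have := Subgroup.map_mono (f := (MulAut.conj h).toMonoidHom)
    (le_conjSubgroup_of_ncard_le hsymm hlarge hle hcard)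
  change conjSubgroup _ _ ≤ conjSubgroup _ (conjSubgroup _ _) at this
  rwa [conjSubgroup_conjSubgroup, mul_inv_cancel_left] at this

end ArtinGroup

/-- In a large-type Artin group, any strictly decreasing chain
`P₀ ⊋ P₁ ⊋ ⋯ ⊋ P_k` of parabolic subgroups satisfies `k ≤ |S|`; in particular
there is no infinite strictly decreasing chain of parabolic subgroups. -/
theorem no_long_descending_chain_of_parabolics {S : Type*} [Finite S] (M : S → S → ℕ∞)
    (hsymm : ∀ s t : S, M s t = M t s)
    (hlarge : ∀ s t : S, s ≠ t → 3 ≤ M s t) :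
    (∀ (k : ℕ) (P : Fin (k + 1) → Subgroup (ArtinGroup M)),
      (∀ i, IsParabolic M (P i)) → StrictAnti P → k ≤ Nat.card S) ∧
    ¬ ∃ P : ℕ → Subgroup (ArtinGroup M),
        (∀ n, IsParabolic M (P n)) ∧ StrictAnti P := by
  have bound : ∀ (k : ℕ) (P : Fin (k + 1) → Subgroup (ArtinGroup M)),
      (∀ i, IsParabolic M (P i)) → StrictAnti P → k ≤ Nat.card S := by
    intro k P hP hanti
    choose g X hX using hP
    have hX' : StrictAnti fun i => (X i).ncard := fun i j hij =>
      ArtinGroup.ncard_lt_ncard_of_conjSubgroup_lt hsymm hlarge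
        (hX i ▸ hX j ▸ hanti hij)
    have hk : ∀ n (hn : n < k + 1), (X ⟨n, hn⟩).ncard + n ≤ Nat.card S := by
      intro n
      induction n with
      | zero => exact fun _ => Set.ncard_le_card _
      | succ n ih =>
        intro hn
        have h1 := ih (by omega)
        have h2 : (X ⟨n + 1, hn⟩).ncard < (X ⟨n, by omega⟩).ncard :=
          hX' (Fin.mk_lt_mk.2 n.lt_succ_self)
        omega
    exact le_of_add_le_right (hk k (by omega))
  refine ⟨bound, ?_⟩
  rintro ⟨P, hP, hanti⟩
  have := bound (Nat.card S + 1) (fun i => P i) (fun i => hP i) fun i j hij => hanti hij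
  omega
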